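/- Let A be a commutative arithmetical ring such that every factor ring of A is finite-dimensional and has no idempotent proper essential ideal. Then A has Krull dimension. -/

import Mathlib

open MulOpposite

/-- Deviation (Gabriel–Rentschler Krull dimension) of a preorder is `≤ α`:
in every strictly descending chain, all but finitely many of the
intervals (corresponding to successive factor modules) have deviation `< α`. -/
def DevLE (α : Ordinal.{0}) (P : Type) (inst : Preorder P) : Prop :=
  ∀ f : ℕ → P, (∀ n : ℕ, inst.lt (f (n + 1)) (f n)) →
    ∃ N : ℕ, ∀ n : ℕ, N ≤ n → ∃ β : Ordinal.{0}, ∃ _ : β < α,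
      DevLE β {x : P // inst.le (f (n + 1)) x ∧ inst.le x (f n)}
        (@Subtype.preorder P inst fun x => inst.le (f (n + 1)) x ∧ inst.le x (f n))
termination_by α

/-- A preorder has Krull dimension (deviation) if its deviation exists as an ordinal. -/
def HasKdimO (P : Type) [inst : Preorder P] : Prop := ∃ α : Ordinal.{0}, DevLE α P inst

/-- A module has Gabriel–Rentschler Krull dimension: the deviation of its submodule
lattice exists (intervals of this lattice are the submodule lattices of the
subquotients, so this agrees with the transfinite definition via factor modules). -/
def ModHasKdim (R M : Type) [Ring R] [AddCommGroup M] [Module R M] : Prop :=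
  HasKdimO (Submodule R M)

/-- A complete lattice (of submodules/ideals) is finite-dimensional: it contains no
infinite independent family (direct sum) of nonzero elements. -/
def FinDimL (L : Type) [CompleteLattice L] : Prop :=
  ¬ ∃ f : ℕ → L, (∀ n, f n ≠ ⊥) ∧ ∀ n, f n ⊓ (⨆ m, ⨆ _ : m ≠ n, f m) = ⊥

/-- A commutative ring is arithmetical if its lattice of ideals is distributive. -/
def Arithmetical (A : Type) [CommRing A] : Prop :=
  ∀ I J K : Ideal A, I ⊓ (J ⊔ K) = I ⊓ J ⊔ I ⊓ K

/-- A commutative ring has no idempotent proper essential ideal. -/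
def NoIdemEss (A : Type) [CommRing A] : Prop :=
  ∀ B : Ideal A, B ≠ ⊤ → (∀ C : Ideal A, C ≠ ⊥ → B ⊓ C ≠ ⊥) → B * B ≠ B

/-! ### Dense intervals in ordered sets -/

/-- The interval from `a` to `b` contains a chain that can be subdivided indefinitely. -/
def DenseBetween {P : Type*} [Preorder P] (a b : P) : Prop :=
  ∃ S : P → P → Prop, S a b ∧ ∀ x y, S x y → x < y ∧ ∃ z, S x z ∧ S z y

namespace DenseBetween

section Preorder

variable {P Q : Type*} [Preorder P] [Preorder Q] {a b c d : P}

theorem lt (h : DenseBetween a b) : a < b := by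
  obtain ⟨S, hab, hS⟩ := h
  exact (hS a b hab).1

theorem split (h : DenseBetween a b) : ∃ c, DenseBetween a c ∧ DenseBetween c b := by
  obtain ⟨S, hab, hS⟩ := h
  obtain ⟨c, hac, hcb⟩ := (hS a b hab).2
  exact ⟨c, ⟨S, hac, hS⟩, ⟨S, hcb, hS⟩⟩

theorem mono (h : DenseBetween c d) (hac : a ≤ c) (hdb : d ≤ b) : DenseBetween a b := by
  obtain ⟨S, hcd, hS⟩ := h
  refine ⟨fun x y => ∃ u v, x ≤ u ∧ v ≤ y ∧ S u v, ⟨c, d, hac, hdb, hcd⟩, ?_⟩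
  rintro x y ⟨u, v, hxu, hvy, huv⟩
  obtain ⟨hlt, z, huz, hzv⟩ := hS u v huv
  exact ⟨(hxu.trans_lt hlt).trans_le hvy, z, ⟨u, z, hxu, le_rfl, huz⟩, ⟨z, v, le_rfl, hvy, hzv⟩⟩

theorem map (h : DenseBetween a b) {f : P → Q}
    (hf : ∀ x y, a ≤ x → x < y → y ≤ b → f x < f y) : DenseBetween (f a) (f b) := by
  obtain ⟨S, hab, hS⟩ := h
  refine ⟨fun u v => ∃ x y, f x = u ∧ f y = v ∧ S x y ∧ a ≤ x ∧ y ≤ b,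
    ⟨a, b, rfl, rfl, hab, le_rfl, le_rfl⟩, ?_⟩
  rintro _ _ ⟨x, y, rfl, rfl, hxy, hax, hyb⟩
  obtain ⟨hlt, z, hxz, hzy⟩ := hS x y hxy
  exact ⟨hf x y hax hlt hyb, f z,
    ⟨x, z, rfl, rfl, hxz, hax, (hS z y hzy).1.le.trans hyb⟩,
    ⟨z, y, rfl, rfl, hzy, hax.trans (hS x z hxz).1.le, hyb⟩⟩

end Preorder

/-- A dense chain in a product projects to a dense chain in one of the factors. -/
theorem map_or {P Q R : Type*} [Preorder P] [PartialOrder Q] [PartialOrder R] {a b : P}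
    (h : DenseBetween a b) {f : P → Q} {g : P → R} (hf : Monotone f) (hg : Monotone g)
    (hfg : ∀ x y, a ≤ x → x < y → y ≤ b → f x = f y → g x < g y) :
    DenseBetween (f a) (f b) ∨ DenseBetween (g a) (g b) := by
  obtain ⟨S, hab, hS⟩ := h
  by_cases hall : ∀ x y, S x y → a ≤ x → y ≤ b → f x < f y
  · left
    refine ⟨fun u v => ∃ x y, f x = u ∧ f y = v ∧ S x y ∧ a ≤ x ∧ y ≤ b,
      ⟨a, b, rfl, rfl, hab, le_rfl, le_rfl⟩, ?_⟩
    rintro _ _ ⟨x, y, rfl, rfl, hxy, hax, hyb⟩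
    obtain ⟨-, z, hxz, hzy⟩ := hS x y hxy
    exact ⟨hall x y hxy hax hyb, f z,
      ⟨x, z, rfl, rfl, hxz, hax, (hS z y hzy).1.le.trans hyb⟩,
      ⟨z, y, rfl, rfl, hzy, hax.trans (hS x z hxz).1.le, hyb⟩⟩
  · right
    push Not at hall
    obtain ⟨x, y, hxy, hax, hyb, hnot⟩ := hall
    have heq : f x = f y := (hf (hS x y hxy).1.le).eq_of_not_lt hnot
    have hdense : DenseBetween x y := ⟨S, hxy, hS⟩
    refine (hdense.map (f := g) fun u v hxu huv hvy => ?_).mono (hg hax) (hg hyb)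
    refine hfg u v (hax.trans hxu) huv (hvy.trans hyb) (le_antisymm (hf huv.le) ?_)
    exact (hf hvy).trans (heq.symm.le.trans (hf hxu))

end DenseBetween

/-! ### Deviation and dense chains -/

theorem DevLE.of_strictMono {α : Ordinal.{0}} : ∀ {P Q : Type} {i : Preorder P} {j : Preorder Q}
    (φ : P → Q), (∀ x y, i.le x y → j.le (φ x) (φ y)) → (∀ x y, i.lt x y → j.lt (φ x) (φ y)) →
    DevLE α Q j → DevLE α P i := by
  induction α using WellFoundedLT.induction with
  | ind α ih =>
    intro P Q i j φ hle hlt h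
    rw [DevLE] at h ⊢
    intro f hf
    obtain ⟨N, hN⟩ := h (fun n => φ (f n)) fun n => hlt _ _ (hf n)
    refine ⟨N, fun n hn => ?_⟩
    obtain ⟨β, hβ, hdev⟩ := hN n hn
    refine ⟨β, hβ, ih β hβ (fun x => ⟨φ x.1, hle _ _ x.2.1, hle _ _ x.2.2⟩) ?_ ?_ hdev⟩
    · exact fun x y hxy => hle _ _ hxy
    · exact fun x y hxy => hlt _ _ hxy

theorem HasKdimO.of_strictMono {P Q : Type} [Preorder P] [Preorder Q] {φ : P → Q}
    (hle : Monotone φ) (hlt : StrictMono φ) (h : HasKdimO Q) : HasKdimO P := by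
  obtain ⟨α, hα⟩ := h
  exact ⟨α, hα.of_strictMono φ (fun _ _ h => hle h) fun _ _ h => hlt h⟩

theorem exists_chain_of_not_hasKdimO {P : Type} [Preorder P] (h : ¬ HasKdimO P) :
    ∃ f : ℕ → P, (∀ n, f (n + 1) < f n) ∧
      ∀ N, ∃ n, N ≤ n ∧ ¬ HasKdimO {x : P // f (n + 1) ≤ x ∧ x ≤ f n} := by
  classical
  let dev : P × P → Ordinal.{0} := fun p =>
    if hp : HasKdimO {x : P // p.1 ≤ x ∧ x ≤ p.2} then Order.succ hp.choose else 0
  have hbound : ¬ DevLE (⨆ p, dev p) P _ := fun hdev => h ⟨_, hdev⟩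
  rw [DevLE] at hbound
  push Not at hbound
  obtain ⟨f, hf, hbad⟩ := hbound
  refine ⟨f, hf, fun N => ?_⟩
  obtain ⟨n, hn, hbad⟩ := hbad N
  refine ⟨n, hn, fun hk => hbad hk.choose ?_ hk.choose_spec⟩
  have hle := Ordinal.le_iSup dev (f (n + 1), f n)
  have heq : dev (f (n + 1), f n) = Order.succ hk.choose := dif_pos hk
  exact (Order.lt_succ _).trans_le (heq ▸ hle)

theorem denseBetween_of_not_hasKdimO_interval {P : Type} [Preorder P] {a b : P}
    (h : ¬ HasKdimO {x : P // a ≤ x ∧ x ≤ b}) : DenseBetween a b := by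
  refine ⟨fun a b => ¬ HasKdimO {x : P // a ≤ x ∧ x ≤ b}, h, fun x y hxy => ?_⟩
  obtain ⟨f, hf, hbad⟩ := exists_chain_of_not_hasKdimO hxy
  have hanti : Antitone f := antitone_nat_of_succ_le fun n => (hf n).le
  refine ⟨(f 1).2.1.trans_lt (lt_of_lt_of_le (show (f 1).1 < (f 0).1 from hf 0) (f 0).2.2), ?_⟩
  obtain ⟨n, -, hn⟩ := hbad 0
  obtain ⟨m, hnm, hm⟩ := hbad (n + 1)
  refine ⟨(f (n + 1)).1, fun hk => hm ?_, fun hk => hn ?_⟩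
  · refine hk.of_strictMono
      (φ := fun u => ⟨u.1.1, u.1.2.1, u.2.2.trans (hanti hnm)⟩) ?_ ?_
    · exact fun u v huv => huv
    · exact fun u v huv => huv
  · refine hk.of_strictMono (φ := fun u => ⟨u.1.1, u.2.1, u.1.2.2⟩) ?_ ?_
    · exact fun u v huv => huv
    · exact fun u v huv => huv

theorem denseBetween_of_not_hasKdimO {P : Type} [Preorder P] [BoundedOrder P]
    (h : ¬ HasKdimO P) : DenseBetween (⊥ : P) ⊤ := by
  obtain ⟨f, -, hbad⟩ := exists_chain_of_not_hasKdimO h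
  obtain ⟨n, -, hn⟩ := hbad 0
  exact (denseBetween_of_not_hasKdimO_interval hn).mono bot_le le_top

/-! ### Dense gaps in distributive lattices -/

/-- The part of `b` lying above `a` contains a dense chain. -/
def DenseGap {L : Type*} [Lattice L] (a b : L) : Prop := DenseBetween (a ⊓ b) b

namespace DenseGap

variable {L : Type*} [Lattice L] {a b c : L}

theorem not_le (h : DenseGap a b) : ¬ b ≤ a := fun hba =>
  (DenseBetween.lt h).not_ge (le_inf hba le_rfl)

theorem _root_.DenseBetween.denseGap (h : DenseBetween a b) : DenseGap a b :=
  DenseBetween.mono h inf_le_left le_rfl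

theorem mono (hd : ∀ a b c : L, a ⊓ (b ⊔ c) = a ⊓ b ⊔ a ⊓ c) {a' b' : L}
    (h : DenseGap a b) (ha : a' ≤ a) (hb : b ≤ b') : DenseGap a' b' := by
  have key : DenseBetween (a ⊓ b ⊔ a ⊓ b') (b ⊔ a ⊓ b') := by
    refine DenseBetween.map h (f := (· ⊔ a ⊓ b')) fun x y hx hxy hy => ?_
    refine lt_of_le_not_ge (sup_le_sup_right hxy.le _) fun hle => hxy.not_ge ?_
    have hy' : y ≤ x ⊔ a ⊓ b' := le_sup_left.trans hle
    rw [← inf_eq_left.2 hy', hd]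
    exact sup_le inf_le_right
      ((le_inf (inf_le_right.trans inf_le_left) (inf_le_left.trans hy)).trans hx)
  exact key.mono (le_sup_of_le_right (inf_le_inf_right _ ha)) (sup_le hb inf_le_right)

theorem sup (hd : ∀ a b c : L, a ⊓ (b ⊔ c) = a ⊓ b ⊔ a ⊓ c)
    (h : DenseGap a (b ⊔ c)) : DenseGap a b ∨ DenseGap a c := by
  have key := DenseBetween.map_or h (f := (· ⊓ b)) (g := (· ⊓ c))
    (fun x y hxy => inf_le_inf_right _ hxy) (fun x y hxy => inf_le_inf_right _ hxy) ?_
  · refine key.imp (fun h => h.mono ?_ inf_le_right) (fun h => h.mono ?_ inf_le_right)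
    · exact le_inf (inf_le_inf_left _ le_sup_left) inf_le_right
    · exact le_inf (inf_le_inf_left _ le_sup_right) inf_le_right
  · intro x y _ hxy hy heq
    refine lt_of_le_not_ge (inf_le_inf_right _ hxy.le) fun hle => hxy.not_ge ?_
    rw [← inf_eq_left.2 hy, hd]
    exact sup_le (heq.symm.le.trans inf_le_left) (hle.trans inf_le_left)

theorem sup_right_of_le (hd : ∀ a b c : L, a ⊓ (b ⊔ c) = a ⊓ b ⊔ a ⊓ c)
    (h : DenseGap a (b ⊔ c)) (hb : b ≤ a) : DenseGap a c :=
  (h.sup hd).resolve_left fun hab => hab.not_le hb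

theorem trans (hd : ∀ a b c : L, a ⊓ (b ⊔ c) = a ⊓ b ⊔ a ⊓ c)
    (h : DenseGap a c) (b : L) : DenseGap a b ∨ DenseGap b c := by
  have key := DenseBetween.map_or h (f := (· ⊓ b)) (g := (· ⊔ b))
    (fun x y hxy => inf_le_inf_right _ hxy) (fun x y hxy => sup_le_sup_right hxy _) ?_
  · refine key.imp (fun h => ?_) fun h => ?_
    · have h' : DenseGap a (c ⊓ b) := DenseBetween.mono h (inf_assoc _ _ _).ge le_rfl
      exact h'.mono hd le_rfl inf_le_right
    · have h' : DenseGap b (b ⊔ c) :=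
        DenseBetween.mono h (inf_le_left.trans le_sup_right) (sup_comm c b).le
      exact h'.sup_right_of_le hd le_rfl
  · intro x y _ hxy _ heq
    refine lt_of_le_not_ge (sup_le_sup_right hxy.le _) fun hle => hxy.not_ge ?_
    have hy : y ≤ x ⊔ b := le_sup_left.trans hle
    rw [← inf_eq_left.2 hy, hd]
    exact sup_le inf_le_right (heq.symm.le.trans inf_le_left)

theorem split (hd : ∀ a b c : L, a ⊓ (b ⊔ c) = a ⊓ b ⊔ a ⊓ c)
    (h : DenseGap a b) : ∃ c, c ≤ b ∧ DenseGap a c ∧ DenseGap (a ⊔ c) b := by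
  obtain ⟨c, hac, hcb⟩ := DenseBetween.split h
  refine ⟨c, hcb.lt.le, ?_, ?_⟩
  · exact DenseBetween.mono hac (inf_le_inf_left _ hcb.lt.le) le_rfl
  · refine DenseBetween.mono hcb ?_ le_rfl
    rw [inf_comm, hd, inf_comm b a]
    exact sup_le hac.lt.le inf_le_right

end DenseGap

/-- Up to gaps without dense chains, the elements above `a` that are densely below `b` are
contained in every element below `b` that they do not contain. -/
def ChainLike {L : Type*} [Lattice L] (a b : L) : Prop :=
  ∀ w x, a ≤ w → DenseGap w b → x ≤ b → ¬ x ≤ w → ¬ DenseGap (a ⊔ x) (w ⊓ b)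

theorem ChainLike.mono_right {L : Type*} [Lattice L]
    (hd : ∀ a b c : L, a ⊓ (b ⊔ c) = a ⊓ b ⊔ a ⊓ c) {a b b' : L} (h : ChainLike a b)
    (hb : b' ≤ b) : ChainLike a b' := fun w x haw hw hx hxw hgap =>
  h w x haw (hw.mono hd le_rfl hb) (hx.trans hb) hxw
    (hgap.mono hd le_rfl (inf_le_inf_left _ hb))

/-- If no dense gap is chain-like, there is an infinite sequence of elements `x n` and `w n`
with `x n ≤ w m` exactly when `n ≠ m`. -/
theorem exists_dual_sequences {L : Type*} [Lattice L] {a b : L} (hab : DenseGap a b)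
    (h : ∀ a b : L, DenseGap a b → ¬ ChainLike a b) :
    ∃ x w : ℕ → L, ∀ n m, x n ≤ w m ↔ n ≠ m := by
  have step : ∀ p : {p : L × L // DenseGap p.1 p.2}, ∃ q : L × L,
      p.1.1 ≤ q.1 ∧ q.2 ≤ p.1.2 ∧ ¬ q.2 ≤ q.1 ∧ DenseGap (p.1.1 ⊔ q.2) (q.1 ⊓ p.1.2) := by
    rintro ⟨⟨a, b⟩, hp⟩
    have hn := h a b hp
    simp only [ChainLike] at hn
    push Not at hn
    obtain ⟨w, x, haw, -, hxb, hxw, hgap⟩ := hn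
    exact ⟨(w, x), haw, hxb, hxw, hgap⟩
  choose q hq₁ hq₂ hq₃ hq₄ using step
  let p : ℕ → {p : L × L // DenseGap p.1 p.2} := fun n =>
    Nat.rec ⟨(a, b), hab⟩ (fun _ p => ⟨(p.1.1 ⊔ (q p).2, (q p).1 ⊓ p.1.2), hq₄ p⟩) n
  have hp : ∀ n, (p (n + 1)).1 = ((p n).1.1 ⊔ (q (p n)).2, (q (p n)).1 ⊓ (p n).1.2) :=
    fun n => rfl
  have hmono : Monotone fun n => (p n).1.1 := monotone_nat_of_le_succ fun n => by
    rw [hp]; exact le_sup_left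
  have hanti : Antitone fun n => (p n).1.2 := antitone_nat_of_succ_le fun n => by
    rw [hp]; exact inf_le_right
  refine ⟨fun n => (q (p n)).2, fun n => (q (p n)).1, fun n m => ⟨?_, fun hne => ?_⟩⟩
  · rintro hle rfl
    exact hq₃ _ hle
  · rcases hne.lt_or_gt with hlt | hlt
    · have h₁ : (q (p n)).2 ≤ (p (n + 1)).1.1 := by rw [hp]; exact le_sup_right
      exact h₁.trans ((hmono (Nat.succ_le_of_lt hlt)).trans (hq₁ _))
    · have h₁ : (p (m + 1)).1.2 ≤ (q (p m)).1 := by rw [hp]; exact inf_le_left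
      exact (hq₂ _).trans ((hanti (Nat.succ_le_of_lt hlt)).trans h₁)

/-! ### Ideals -/

section Ideals

variable {A : Type*} [CommRing A]

/-- The ideal of all `a` with `a * y ∈ I`. -/
def Ideal.quotientBy (I : Ideal A) (y : A) : Ideal A :=
  Submodule.comap (LinearMap.toSpanSingleton A A y) I

theorem Ideal.mem_quotientBy {I : Ideal A} {y a : A} : a ∈ I.quotientBy y ↔ a * y ∈ I := by
  simp [Ideal.quotientBy]

theorem Ideal.le_quotientBy (I : Ideal A) (y : A) : I ≤ I.quotientBy y := fun _ ha =>
  Ideal.mem_quotientBy.2 (I.mul_mem_right y ha)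

theorem DenseGap.quotientBy {I : Ideal A} {y : A} (h : DenseGap I (Ideal.span {y})) :
    DenseGap (I.quotientBy y) ⊤ := by
  have key := DenseBetween.map h (f := fun B : Ideal A => B.quotientBy y) ?_
  · refine key.mono ?_ le_top
    intro a ha
    have ha' : a ∈ I.quotientBy y := (Submodule.mem_inf.1 ha).1
    exact Ideal.mem_quotientBy.2 (Submodule.mem_inf.2
      ⟨Ideal.mem_quotientBy.1 ha', Ideal.mul_mem_left _ _ (Ideal.mem_span_singleton_self y)⟩)
  · intro B C _ hBC hC
    obtain ⟨hle, c, hcC, hcB⟩ := SetLike.lt_iff_le_and_exists.1 hBC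
    obtain ⟨a, rfl⟩ := Ideal.mem_span_singleton'.1 (hC hcC)
    refine SetLike.lt_iff_le_and_exists.2 ⟨Submodule.comap_mono hle, a, ?_, ?_⟩
    · exact Ideal.mem_quotientBy.2 hcC
    · exact fun ha => hcB (Ideal.mem_quotientBy.1 ha)

theorem Ideal.mem_map_toSpanSingleton_sup {I B : Ideal A} {x z : A} :
    z ∈ I ⊔ Submodule.map (LinearMap.toSpanSingleton A A x) B ↔
      ∃ b ∈ B, z - b * x ∈ I := by
  constructor
  · intro hz
    obtain ⟨i, hi, w, hw, rfl⟩ := Submodule.mem_sup.1 hz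
    obtain ⟨b, hb, rfl⟩ := Submodule.mem_map.1 hw
    exact ⟨b, hb, by simpa using hi⟩
  · rintro ⟨b, hb, hz⟩
    exact Submodule.mem_sup.2 ⟨_, hz, b * x, Submodule.mem_map.2 ⟨b, hb, by simp⟩, by ring⟩

theorem Ideal.le_of_map_toSpanSingleton_le {I B C : Ideal A} {x : A} (hB : I.quotientBy x ≤ B)
    (h : Submodule.map (LinearMap.toSpanSingleton A A x) C ≤
      I ⊔ Submodule.map (LinearMap.toSpanSingleton A A x) B) : C ≤ B := by
  intro c hc
  have hcx : c * x ∈ Submodule.map (LinearMap.toSpanSingleton A A x) C :=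
    Submodule.mem_map.2 ⟨c, hc, by simp⟩
  obtain ⟨b, hb, hI⟩ := Ideal.mem_map_toSpanSingleton_sup.1 (h hcx)
  have : c - b ∈ B := hB (Ideal.mem_quotientBy.2 (by rwa [sub_mul]))
  simpa using B.add_mem this hb

theorem DenseBetween.map_toSpanSingleton {I B C : Ideal A} {x : A}
    (h : DenseBetween B C) (hB : I.quotientBy x ≤ B) :
    DenseBetween (I ⊔ Submodule.map (LinearMap.toSpanSingleton A A x) B)
      (I ⊔ Submodule.map (LinearMap.toSpanSingleton A A x) C) := by
  refine h.map (f := fun D : Ideal A => I ⊔ Submodule.map (LinearMap.toSpanSingleton A A x) D)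
    fun D E hD hDE _ => ?_
  refine lt_of_le_not_ge (sup_le_sup_left (Submodule.map_mono hDE.le) _) fun hle => ?_
  exact hDE.not_ge (Ideal.le_of_map_toSpanSingleton_le (hB.trans hD) (le_sup_right.trans hle))

theorem ChainLike.quotientBy (hd : ∀ I J K : Ideal A, I ⊓ (J ⊔ K) = I ⊓ J ⊔ I ⊓ K)
    {I : Ideal A} {x : A} (h : ChainLike I (Ideal.span {x})) :
    ChainLike (I.quotientBy x) ⊤ := by
  intro W X hIW hW _ hXW hgap
  rw [inf_top_eq] at hgap
  have hmap : ∀ B : Ideal A,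
      Submodule.map (LinearMap.toSpanSingleton A A x) B ≤ Ideal.span {x} := by
    rintro B _ ⟨b, -, rfl⟩
    simpa using Ideal.mul_mem_left _ b (Ideal.mem_span_singleton_self x)
  refine h (I ⊔ Submodule.map (LinearMap.toSpanSingleton A A x) W)
    (Submodule.map (LinearMap.toSpanSingleton A A x) X) le_sup_left ?_ (hmap X) ?_ ?_
  · have hW' : DenseBetween W ⊤ := DenseBetween.mono hW (by simp) le_rfl
    have := (hW'.map_toSpanSingleton hIW).denseGap
    exact (this.sup_right_of_le hd le_sup_left).mono hd le_rfl (hmap ⊤)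
  · exact fun hle => hXW (Ideal.le_of_map_toSpanSingleton_le hIW hle)
  · have hbetween := DenseBetween.map_toSpanSingleton (I := I) (x := x) hgap
      (le_inf le_sup_left hIW)
    have hgap' : DenseGap (I ⊔ Submodule.map (LinearMap.toSpanSingleton A A x) X)
        (I ⊔ Submodule.map (LinearMap.toSpanSingleton A A x) W) := by
      refine DenseBetween.mono hbetween ?_ le_rfl
      intro z hz
      obtain ⟨hzX, hzW⟩ := Submodule.mem_inf.1 hz
      obtain ⟨a, ha, hza⟩ := Ideal.mem_map_toSpanSingleton_sup.1 hzX
      obtain ⟨b, hb, hzb⟩ := Ideal.mem_map_toSpanSingleton_sup.1 hzW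
      refine Ideal.mem_map_toSpanSingleton_sup.2 ⟨b, Submodule.mem_inf.2 ⟨?_, hb⟩, hzb⟩
      refine Submodule.mem_sup.2 ⟨b - a, Ideal.mem_quotientBy.2 ?_, a, ha, by ring⟩
      have := I.sub_mem hza hzb
      rwa [show z - a * x - (z - b * x) = (b - a) * x by ring] at this
    exact (hgap'.sup_right_of_le hd le_sup_left).mono hd le_rfl (le_inf le_sup_right (hmap W))

/-- A chain-like dense gap of ideals yields a chain-like dense gap below the unit ideal. -/
theorem ChainLike.exists_top (hd : ∀ I J K : Ideal A, I ⊓ (J ⊔ K) = I ⊓ J ⊔ I ⊓ K)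
    {I M : Ideal A} (hgap : DenseGap I M) (h : ChainLike I M) :
    ∃ J : Ideal A, DenseGap J ⊤ ∧ ChainLike J ⊤ := by
  obtain ⟨C, hCM, hIC, hC⟩ := hgap.split hd
  obtain ⟨x, hxM, hxC⟩ := SetLike.not_le_iff_exists.1 hC.not_le
  have hxM' : Ideal.span {x} ≤ M := (Ideal.span_singleton_le_iff_mem M).2 hxM
  have hsmall := h (I ⊔ C) (Ideal.span {x}) le_sup_left hC hxM'
    (by rwa [Ideal.span_singleton_le_iff_mem])
  have hIx : DenseGap I (I ⊔ Ideal.span {x}) :=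
    (hIC.trans hd _).resolve_right fun hbad =>
      hsmall (hbad.mono hd le_rfl (le_inf le_sup_right hCM))
  exact ⟨I.quotientBy x, (hIx.sup_right_of_le hd le_rfl).quotientBy,
    (h.mono_right hd hxM').quotientBy hd⟩

/-- A chain-like dense gap below the unit ideal produces an idempotent ideal that is not contained
in any sum of a principal ideal `(u)`, for `u` in that ideal, with the lower end of the gap. -/
theorem ChainLike.exists_idempotent (hd : ∀ I J K : Ideal A, I ⊓ (J ⊔ K) = I ⊓ J ⊔ I ⊓ K)
    {I : Ideal A} (hgap : DenseGap I ⊤) (h : ChainLike I ⊤) :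
    ∃ U : Ideal A, U * U = U ∧ ∀ u ∈ U, ¬ U ≤ I ⊔ Ideal.span {u} := by
  let 𝒲 : Set (Ideal A) := {W | I ≤ W ∧ DenseGap W ⊤}
  have hnot : ∀ W ∈ 𝒲, ∀ X : Ideal A, ¬ X ≤ W → ¬ DenseGap (I ⊔ X) W := fun W hW X hX hbad =>
    h W X hW.1 hW.2 le_top hX (by rwa [inf_top_eq])
  have hsucc : ∀ W ∈ 𝒲, ∃ V ∈ 𝒲, W ≤ V ∧ DenseGap W V := by
    rintro W ⟨hIW, hW⟩
    obtain ⟨V, -, hWV, hV⟩ := hW.split hd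
    exact ⟨W ⊔ V, ⟨hIW.trans le_sup_left, hV⟩, le_sup_left, hWV.mono hd le_rfl le_sup_right⟩
  have hdir : DirectedOn (· ≤ ·) 𝒲 := by
    intro W₁ hW₁ W₂ hW₂
    obtain ⟨V, hV, hWV, hgapV⟩ := hsucc W₁ hW₁
    by_cases h₂ : W₂ ≤ V
    · exact ⟨V, hV, hWV, h₂⟩
    · refine ⟨W₂, hW₂, ?_, le_rfl⟩
      by_contra h₁
      rcases hgapV.trans hd W₂ with hbad | hbad
      · exact hnot W₂ hW₂ W₁ h₁ (by rwa [sup_eq_right.2 hW₁.1])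
      · exact hnot V hV W₂ h₂ (by rwa [sup_eq_right.2 hW₂.1])
  have hne : 𝒲.Nonempty := ⟨I, le_rfl, hgap⟩
  have hmem : ∀ {u}, u ∈ sSup 𝒲 ↔ ∃ W ∈ 𝒲, u ∈ W := fun {u} =>
    Submodule.mem_sSup_of_directed hne hdir
  refine ⟨sSup 𝒲, le_antisymm Ideal.mul_le_left (sSup_le fun W hW w hw => ?_), fun u hu hle => ?_⟩
  · obtain ⟨V, hV, hWV, hgapV⟩ := hsucc W hW
    obtain ⟨W', hW', hVW', hgapW'⟩ := hsucc V hV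
    have hsq : ∀ y ∈ W', y ∉ V → W ⊓ Ideal.span {y} ≤ sSup 𝒲 * sSup 𝒲 := by
      intro y hy hyV z hz
      obtain ⟨hzW, hzy⟩ := Submodule.mem_inf.1 hz
      obtain ⟨a, rfl⟩ := Ideal.mem_span_singleton'.1 hzy
      have h₁ : DenseGap W (I ⊔ Ideal.span {y}) := (hgapV.trans hd _).resolve_right
        (hnot V hV _ (by rwa [Ideal.span_singleton_le_iff_mem]))
      have h₂ : W.quotientBy y ∈ 𝒲 :=
        ⟨hW.1.trans (W.le_quotientBy y), (h₁.sup_right_of_le hd hW.1).quotientBy⟩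
      exact Ideal.mul_mem_mul (hmem.2 ⟨_, h₂, Ideal.mem_quotientBy.2 hzW⟩) (hmem.2 ⟨W', hW', hy⟩)
    obtain ⟨y, hy, hyV⟩ := SetLike.not_le_iff_exists.1 hgapW'.not_le
    have hwV : w ∈ V := hWV hw
    have hwy : w ∈ W ⊓ (Ideal.span {y} ⊔ Ideal.span {w + y}) := by
      refine Submodule.mem_inf.2 ⟨hw, Submodule.mem_sup.2 ⟨-y, ?_, w + y, ?_, by ring⟩⟩
      · exact neg_mem (Ideal.mem_span_singleton_self y)
      · exact Ideal.mem_span_singleton_self _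
    rw [hd] at hwy
    refine sup_le (hsq y hy hyV) (hsq (w + y) (W'.add_mem (hVW' hwV) hy) fun hbad => hyV ?_) hwy
    simpa using V.sub_mem hbad hwV
  · obtain ⟨W, hW, huW⟩ := hmem.1 hu
    obtain ⟨V, hV, -, hgapV⟩ := hsucc W hW
    exact hgapV.not_le ((le_sSup hV).trans
      (hle.trans (sup_le hW.1 ((Ideal.span_singleton_le_iff_mem W).2 huW))))

end Ideals

/-- If no factor ring has an idempotent proper essential ideal, then every idempotent ideal is
principal modulo every ideal. -/
theorem exists_le_sup_span_of_idempotent {A : Type*} [CommRing A]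
    (hni : ∀ I : Ideal A, ∀ B : Ideal (A ⧸ I), B ≠ ⊤ →
      (∀ C : Ideal (A ⧸ I), C ≠ ⊥ → B ⊓ C ≠ ⊥) → B * B ≠ B)
    (I : Ideal A) {U : Ideal A} (hU : U * U = U) : ∃ u ∈ U, U ≤ I ⊔ Ideal.span {u} := by
  obtain ⟨C, -, hC⟩ := zorn_le_nonempty₀ {C : Ideal A | C ⊓ U ≤ I} (by
    intro c hc hchain D hD
    refine ⟨sSup c, fun z hz => ?_, fun E hE => le_sSup hE⟩
    obtain ⟨hzc, hzU⟩ := Submodule.mem_inf.1 hz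
    obtain ⟨E, hE, hzE⟩ := (Submodule.mem_sSup_of_directed ⟨D, hD⟩ hchain.directedOn).1 hzc
    exact hc hE (Submodule.mem_inf.2 ⟨hzE, hzU⟩)) ⊥ (by simp)
  have hsum : U ⊔ C = ⊤ := by
    by_contra hne
    refine hni C (U.map (Ideal.Quotient.mk C)) (fun htop => hne ?_) (fun D hD hbot => ?_)
      (by rw [← Ideal.map_mul, hU])
    · have := congrArg (Ideal.comap (Ideal.Quotient.mk C)) htop
      rwa [Ideal.comap_map_of_surjective' _ Ideal.Quotient.mk_surjective, Ideal.mk_ker,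
        Ideal.comap_top] at this
    · have hCD : C ≤ D.comap (Ideal.Quotient.mk C) := by
        conv_lhs => rw [← Ideal.mk_ker (I := C)]
        exact Ideal.comap_mono bot_le
      have hmem : D.comap (Ideal.Quotient.mk C) ⊓ U ≤ I := by
        intro z hz
        obtain ⟨hzD, hzU⟩ := Submodule.mem_inf.1 hz
        have h0 : Ideal.Quotient.mk C z ∈ U.map (Ideal.Quotient.mk C) ⊓ D :=
          Submodule.mem_inf.2 ⟨Ideal.mem_map_of_mem _ hzU, hzD⟩
        rw [hbot, Ideal.mem_bot, Ideal.Quotient.eq_zero_iff_mem] at h0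
        exact hC.prop (Submodule.mem_inf.2 ⟨h0, hzU⟩)
      refine hD (eq_bot_iff.2 fun d hdD => ?_)
      obtain ⟨a, rfl⟩ := Ideal.Quotient.mk_surjective d
      exact Ideal.Quotient.eq_zero_iff_mem.2 (hC.le_of_ge hmem hCD hdD)
  obtain ⟨u, hu, c, hc, huc⟩ :=
    Submodule.mem_sup.1 (hsum.symm ▸ Submodule.mem_top : (1 : A) ∈ U ⊔ C)
  refine ⟨u, hu, fun z hz => Submodule.mem_sup.2 ⟨c * z, ?_, u * z, ?_, ?_⟩⟩
  · exact hC.prop (Submodule.mem_inf.2 ⟨C.mul_mem_right z hc, U.mul_mem_left c hz⟩)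
  · exact Ideal.mul_mem_right _ _ (Ideal.mem_span_singleton_self u)
  · rw [← add_mul, add_comm c u, huc, one_mul]

theorem not_finDimL_quotient_of_dual_sequences {A : Type} [CommRing A] {x w : ℕ → Ideal A}
    (h : ∀ n m, x n ≤ w m ↔ n ≠ m) : ¬ FinDimL (Ideal (A ⧸ ⨅ n, w n)) := by
  rw [FinDimL, not_not]
  refine ⟨fun n => (x n).map (Ideal.Quotient.mk (⨅ n, w n)), fun n hbot => ?_, fun n => ?_⟩
  · rw [Ideal.map_eq_bot_iff_le_ker, Ideal.mk_ker] at hbot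
    exact (h n n).1 (hbot.trans (iInf_le w n)) rfl
  · have hle : ⨆ m, ⨆ _ : m ≠ n, (x m).map (Ideal.Quotient.mk (⨅ n, w n)) ≤
        (w n).map (Ideal.Quotient.mk (⨅ n, w n)) :=
      iSup₂_le fun m hm => Ideal.map_mono ((h m n).2 hm)
    refine eq_bot_iff.2 fun z hz => ?_
    obtain ⟨hzx, hzw⟩ := Submodule.mem_inf.1 hz
    obtain ⟨a, ha, rfl⟩ :=
      (Ideal.mem_map_iff_of_surjective _ Ideal.Quotient.mk_surjective).1 hzx
    have haw : a ∈ w n := by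
      obtain ⟨b, hb, hab⟩ :=
        (Ideal.mem_map_iff_of_surjective _ Ideal.Quotient.mk_surjective).1 (hle hzw)
      have := iInf_le w n (Ideal.Quotient.eq.1 hab)
      simpa using (w n).sub_mem hb this
    refine Ideal.Quotient.eq_zero_iff_mem.2 (Submodule.mem_iInf _ |>.2 fun m => ?_)
    by_cases hm : n = m
    · exact hm ▸ haw
    · exact (h n m).2 hm ha

theorem stmt13 (A : Type) [CommRing A] (ha : Arithmetical A)
    (hfd : ∀ I : Ideal A, FinDimL (Ideal (A ⧸ I)))
    (hni : ∀ I : Ideal A, NoIdemEss (A ⧸ I)) :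
    HasKdimO (Ideal A) := by
  by_contra hk
  by_cases h : ∃ I M : Ideal A, DenseGap I M ∧ ChainLike I M
  · obtain ⟨I, M, hgap, hchain⟩ := h
    obtain ⟨J, hJgap, hJchain⟩ := hchain.exists_top ha hgap
    obtain ⟨U, hU, hUJ⟩ := hJchain.exists_idempotent ha hJgap
    obtain ⟨u, hu, hle⟩ := exists_le_sup_span_of_idempotent hni J hU
    exact hUJ u hu hle
  · push Not at h
    obtain ⟨x, w, hxw⟩ := exists_dual_sequences (denseBetween_of_not_hasKdimO hk).denseGap h
    exact not_finDimL_quotient_of_dual_sequences hxw (hfd _)
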